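/- Let A be a finite-dimensional Hopf algebra over a field k. Then the cohomology ring H^•(A,k) = Ext^•_A(k,k), with multiplication given by the cup product (equivalently, Yoneda composition), is a graded commutative k-algebra: for homogeneous elements x ∈ H^m(A,k) and y ∈ H^n(A,k), one has x·y = (−1)^{mn} y·x. In particular, the even part H^ev(A,k) is a commutative ring. -/

import Mathlib

/-!
STATEMENT 7.
Let `A` be a finite-dimensional Hopf algebra over a field `k`.  Then the cohomology ring
`H^•(A,k) = Ext^•_A(k,k)`, with multiplication given by Yoneda composition (equivalently,
the cup product), is graded commutative: for homogeneous elements `x ∈ H^m(A,k)` and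
`y ∈ H^n(A,k)` one has `x·y = (−1)^{mn} y·x`.  In particular, the even part `H^ev(A,k)`
is commutative.

Here `k` is the trivial `A`-module given by the counit `ε` (the instance `[Module A k]`
pinned down by `hk`), `Abelian.Ext` is the Ext group in the abelian category of left
`A`-modules, and `Ext.comp` is Yoneda composition.  The sign `(−1)^{mn}` acts through the
integer action on the abelian group `Ext^{m+n}_A(k,k)`.
-/

open CategoryTheory

universe v u

namespace CategoryTheory

open Limits

universe w v₁ u₁

section GradedInterchange

variable {C : Type u₁} [Category.{v₁} C] [Abelian C]

/-- In a commutative `3 × 3` grid with short exact rows and last column, let `J` be the kernel of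
the diagonal epimorphism onto the bottom right corner.  Then `J` is also the quotient of the
sum of the two objects adjacent to the top left corner by the antidiagonal copy of that corner. -/
lemma ShortComplex.exists_antidiagonal_shortExact (S : ShortComplex (ShortComplex C))
    (h₁ : S.X₁.ShortExact) (h₂ : S.X₂.ShortExact) (h₃ : S.X₃.ShortExact)
    {z₃ : S.f.τ₃ ≫ S.g.τ₃ = 0} (k₃ : (ShortComplex.mk _ _ z₃).ShortExact) :
    ∃ (J : C) (ι : J ⟶ S.X₂.X₂) (p : J ⟶ S.X₁.X₃) (q : J ⟶ S.X₃.X₁)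
      (a : S.X₁.X₂ ⟶ J) (b : S.X₂.X₁ ⟶ J)
      (w : ι ≫ S.X₂.g ≫ S.g.τ₃ = 0)
      (w' : biprod.lift S.X₁.f (-S.f.τ₁) ≫ biprod.desc a b = 0),
      p ≫ S.f.τ₃ = ι ≫ S.X₂.g ∧ q ≫ S.X₃.f = ι ≫ S.g.τ₂ ∧
      a ≫ p = S.X₁.g ∧ b ≫ p = 0 ∧ a ≫ q = 0 ∧ b ≫ q = S.g.τ₁ ∧
      (ShortComplex.mk ι (S.X₂.g ≫ S.g.τ₃) w).ShortExact ∧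
      (ShortComplex.mk (biprod.lift S.X₁.f (-S.f.τ₁)) (biprod.desc a b) w').ShortExact := by
  have m1 : Mono S.X₁.f := h₁.mono_f
  have m2 : Mono S.X₂.f := h₂.mono_f
  have m3 : Mono S.X₃.f := h₃.mono_f
  have e1 : Epi S.X₁.g := h₁.epi_g
  have e2 : Epi S.X₂.g := h₂.epi_g
  have z₂ : S.f.τ₂ ≫ S.g.τ₂ = 0 := congrArg ShortComplex.Hom.τ₂ S.zero
  have n3 : Mono S.f.τ₃ := k₃.mono_f
  have f3 : Epi S.g.τ₃ := k₃.epi_g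
  let r := S.X₂.g ≫ S.g.τ₃
  let ι := kernel.ι r
  have hι : ι ≫ S.X₂.g ≫ S.g.τ₃ = 0 := kernel.condition r
  obtain ⟨p, hp⟩ : ∃ p : kernel r ⟶ S.X₁.X₃, p ≫ S.f.τ₃ = ι ≫ S.X₂.g :=
    ⟨k₃.exact.lift (ι ≫ S.X₂.g) (by simpa [r] using hι), k₃.exact.lift_f _ _⟩
  obtain ⟨q, hq⟩ : ∃ q : kernel r ⟶ S.X₃.X₁, q ≫ S.X₃.f = ι ≫ S.g.τ₂ :=
    ⟨h₃.exact.lift (ι ≫ S.g.τ₂) (by simpa [S.g.comm₂₃] using hι), h₃.exact.lift_f _ _⟩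
  obtain ⟨a, ha⟩ : ∃ a : S.X₁.X₂ ⟶ kernel r, a ≫ ι = S.f.τ₂ :=
    ⟨kernel.lift r S.f.τ₂ (by simp [r, S.f.comm₂₃_assoc, z₃]), kernel.lift_ι _ _ _⟩
  obtain ⟨b, hb⟩ : ∃ b : S.X₂.X₁ ⟶ kernel r, b ≫ ι = S.X₂.f :=
    ⟨kernel.lift r S.X₂.f (by simp [r]), kernel.lift_ι _ _ _⟩
  have w' : biprod.lift S.X₁.f (-S.f.τ₁) ≫ biprod.desc a b = 0 := by
    rw [← cancel_mono ι]; simp [ha, hb, S.f.comm₁₂]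
  have hap : a ≫ p = S.X₁.g := by
    rw [← cancel_mono S.f.τ₃, Category.assoc, hp, reassoc_of% ha, S.f.comm₂₃]
  have hbp : b ≫ p = 0 := by
    rw [← cancel_mono S.f.τ₃, Category.assoc, hp, reassoc_of% hb]; simp
  refine ⟨kernel r, ι, p, q, a, b, hι, w', hp, hq, hap, hbp, ?_, ?_, ?_, ?_⟩
  · rw [← cancel_mono S.X₃.f, Category.assoc, hq, reassoc_of% ha, z₂, zero_comp]
  · rw [← cancel_mono S.X₃.f, Category.assoc, hq, reassoc_of% hb, S.g.comm₁₂]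
  · have : Epi (S.X₂.g ≫ S.g.τ₃) := epi_comp _ _
    exact { exact := ShortComplex.exact_kernel r
            mono_f := inferInstanceAs (Mono (kernel.ι r))
            epi_g := this }
  · refine { exact := ?_, mono_f := ?_, epi_g := ?_ }
    · rw [ShortComplex.exact_iff_exact_up_to_refinements]
      intro A x hx
      dsimp at x hx
      obtain ⟨x, y, rfl⟩ : ∃ x' y', x = biprod.lift x' y' :=
        ⟨x ≫ biprod.fst, x ≫ biprod.snd, by ext <;> simp⟩
      have hx : x ≫ a + y ≫ b = 0 := by simpa using hx
      have hxp := hx =≫ p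
      have hxi := hx =≫ ι
      simp only [Preadditive.add_comp, Category.assoc, hap, hbp, ha, hb, comp_zero, add_zero,
        zero_comp] at hxp hxi
      have hz := h₁.exact.lift_f x hxp
      refine ⟨A, 𝟙 A, inferInstance, h₁.exact.lift x hxp, ?_⟩
      dsimp
      rw [Category.id_comp]
      ext
      · simp
      · simp only [biprod.lift_snd, Category.assoc]
        rw [← cancel_mono S.X₂.f, eq_neg_of_add_eq_zero_right hxi]
        simp [S.f.comm₁₂, reassoc_of% hz]
    · have : Mono (biprod.lift S.X₁.f (-S.f.τ₁) ≫ biprod.fst) := by rwa [biprod.lift_fst]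
      exact mono_of_mono _ biprod.fst
    · rw [epi_iff_surjective_up_to_refinements]
      intro A j
      obtain ⟨A', π, hπ, x, hx⟩ := surjective_up_to_refinements_of_epi S.X₁.g (j ≫ p)
      have hy : (π ≫ j ≫ ι - x ≫ S.f.τ₂) ≫ S.X₂.g = 0 := by
        simp [← S.f.comm₂₃, ← hp, reassoc_of% hx]
      refine ⟨A', π, hπ, biprod.lift x (h₂.exact.lift _ hy), ?_⟩
      rw [← cancel_mono ι]
      have := h₂.exact.lift_f _ hy
      simp [ha, hb, this]

variable [HasExt.{w} C]
open Abelian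

/-- The extension class of a short exact sequence given by explicit morphisms. -/
noncomputable def Abelian.Ext.δ {X₁ X₂ X₃ : C} {f : X₁ ⟶ X₂} {g : X₂ ⟶ X₃} {w : f ≫ g = 0}
    (h : (ShortComplex.mk f g w).ShortExact) : Ext.{w} X₃ X₁ 1 :=
  h.extClass

lemma Abelian.Ext.δ_naturality {X₁ X₂ X₃ Y₁ Y₂ Y₃ : C}
    {f : X₁ ⟶ X₂} {g : X₂ ⟶ X₃} {w : f ≫ g = 0} (h : (ShortComplex.mk f g w).ShortExact)
    {f' : Y₁ ⟶ Y₂} {g' : Y₂ ⟶ Y₃} {w' : f' ≫ g' = 0} (h' : (ShortComplex.mk f' g' w').ShortExact)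
    (τ₁ : X₁ ⟶ Y₁) (τ₂ : X₂ ⟶ Y₂) (τ₃ : X₃ ⟶ Y₃) (comm₁₂ : τ₁ ≫ f' = f ≫ τ₂)
    (comm₂₃ : τ₂ ≫ g' = g ≫ τ₃) :
    (Ext.δ.{w} h).comp (Ext.mk₀ τ₁) (add_zero 1) = (Ext.mk₀ τ₃).comp (Ext.δ h') (zero_add 1) :=
  h.extClass_naturality h' { τ₁ := τ₁, τ₂ := τ₂, τ₃ := τ₃ }

lemma Abelian.Ext.mapExactFunctor_δ (F : C ⥤ C) [F.Additive] [PreservesFiniteLimits F]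
    [PreservesFiniteColimits F] {X₁ X₂ X₃ : C} {f : X₁ ⟶ X₂} {g : X₂ ⟶ X₃} {w : f ≫ g = 0}
    (h : (ShortComplex.mk f g w).ShortExact) {w' : F.map f ≫ F.map g = 0}
    (h' : (ShortComplex.mk (F.map f) (F.map g) w').ShortExact) :
    (Ext.δ.{w} h).mapExactFunctor F = Ext.δ h' :=
  Ext.mapExactFunctor_extClass F h

/-- The two ways around a `3 × 3` grid with short exact rows and columns give opposite classes
in `Ext` of degree two. -/
lemma Abelian.Ext.δ_comp_δ_add_δ_comp_δ (S : ShortComplex (ShortComplex C))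
    (h₁ : S.X₁.ShortExact) (h₂ : S.X₂.ShortExact) (h₃ : S.X₃.ShortExact)
    {z₁ : S.f.τ₁ ≫ S.g.τ₁ = 0} {z₃ : S.f.τ₃ ≫ S.g.τ₃ = 0}
    (k₁ : (ShortComplex.mk _ _ z₁).ShortExact) (k₃ : (ShortComplex.mk _ _ z₃).ShortExact) :
    (Ext.δ.{w} k₃).comp (Ext.δ h₁) (rfl : 1 + 1 = 2) +
      (Ext.δ h₃).comp (Ext.δ k₁) (rfl : 1 + 1 = 2) = 0 := by
  obtain ⟨J, ι, p, q, a, b, w, w', hp, hq, hap, hbp, haq, hbq, hJ, hK⟩ :=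
    S.exists_antidiagonal_shortExact h₁ h₂ h₃ k₃
  have E₁ := Ext.δ_naturality.{w} hJ k₃ p S.X₂.g (𝟙 _) hp (by simp)
  have E₂ := Ext.δ_naturality.{w} hJ h₃ q S.g.τ₂ (𝟙 _) hq (by simp [S.g.comm₂₃])
  have E₃ := Ext.δ_naturality.{w} hK h₁ (𝟙 _) biprod.fst p (by simp) (by ext <;> simp [hap, hbp])
  have E₄ := Ext.δ_naturality.{w} hK k₁ (-𝟙 _) biprod.snd q (by simp)
    (by ext <;> simp [haq, hbq])
  simp only [Ext.mk₀_id_comp, Ext.comp_mk₀_id, Ext.mk₀_neg, Ext.comp_neg] at E₁ E₂ E₃ E₄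
  rw [← E₁, ← E₂, Ext.comp_assoc_of_second_deg_zero, Ext.comp_assoc_of_second_deg_zero,
    ← Ext.comp_add, ← E₃, ← E₄, add_neg_cancel, Ext.comp_zero]

/-- Every `Ext` class is built from morphisms by repeated composition on the left with extension
classes of short exact sequences. -/
lemma Abelian.Ext.induction_δ [EnoughProjectives C] {Y : C}
    {P : ∀ (n : ℕ) (X : C), Ext.{w} X Y n → Prop}
    (mk₀ : ∀ (X : C) (f : X ⟶ Y), P 0 X (Ext.mk₀ f))
    (δ_comp : ∀ (n : ℕ) (X₁ X₂ X₃ : C) (f : X₁ ⟶ X₂) (g : X₂ ⟶ X₃) (w : f ≫ g = 0)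
      (h : (ShortComplex.mk f g w).ShortExact) (x : Ext X₁ Y n),
      P n X₁ x → P (n + 1) X₃ ((Ext.δ h).comp x (add_comm 1 n)))
    {n : ℕ} {X : C} (x : Ext X Y n) : P n X x := by
  induction n generalizing X with
  | zero =>
    obtain ⟨f, rfl⟩ := (Ext.mk₀_bijective X Y).2 x
    exact mk₀ X f
  | succ n ih =>
    have w : kernel.ι (Projective.π X) ≫ Projective.π X = 0 := by simp
    have h : (ShortComplex.mk _ _ w).ShortExact :=
      { exact := ShortComplex.exact_kernel _
        mono_f := inferInstanceAs (Mono (kernel.ι _))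
        epi_g := inferInstanceAs (Epi (Projective.π X)) }
    have : Projective (ShortComplex.mk _ _ w).X₂ := inferInstanceAs (Projective (Projective.over X))
    obtain ⟨x', rfl⟩ := Ext.contravariant_sequence_exact₃ h Y x (Ext.eq_zero_of_projective _)
      (add_comm 1 n)
    exact δ_comp n _ _ _ _ _ w h x' (ih x')

lemma Abelian.Ext.comp_zsmul {X Y Z : C} {m n p : ℕ} (x : Ext.{w} X Y m) (r : ℤ)
    (y : Ext.{w} Y Z n) (h : m + n = p) : x.comp (r • y) h = r • x.comp y h :=
  map_zsmul (x.precomp Z h) r y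

lemma Abelian.Ext.zsmul_comp {X Y Z : C} {m n p : ℕ} (r : ℤ) (x : Ext.{w} X Y m)
    (y : Ext.{w} Y Z n) (h : m + n = p) : (r • x).comp y h = r • x.comp y h :=
  map_zsmul (y.postcomp X h) r x

variable [EnoughProjectives C]

lemma Abelian.Ext.mapExactFunctor_id {X Y : C} {n : ℕ} (x : Ext.{w} X Y n) :
    x.mapExactFunctor (𝟭 C) = x := by
  induction x using Ext.induction_δ with
  | mk₀ X f => exact Ext.mapExactFunctor_mk₀ _ _
  | δ_comp n X₁ X₂ X₃ f g w h x ih =>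
    rw [Ext.mapExactFunctor_comp, Ext.mapExactFunctor_δ (𝟭 C) h h, ih]

lemma Abelian.Ext.mapExactFunctor_naturality {F G : C ⥤ C} (τ : F ⟶ G)
    [F.Additive] [PreservesFiniteLimits F] [PreservesFiniteColimits F]
    [G.Additive] [PreservesFiniteLimits G] [PreservesFiniteColimits G]
    {X Y : C} {n : ℕ} (x : Ext.{w} X Y n) :
    (Ext.mk₀ (τ.app X)).comp (x.mapExactFunctor G) (zero_add n) =
      (x.mapExactFunctor F).comp (Ext.mk₀ (τ.app Y)) (add_zero n) := by
  induction x using Ext.induction_δ with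
  | mk₀ X f => simp [Ext.mapExactFunctor_mk₀]
  | δ_comp n X₁ X₂ X₃ f g w h x ih =>
    rw [Ext.mapExactFunctor_comp, Ext.mapExactFunctor_comp,
      Ext.mapExactFunctor_δ F h (h.map_of_exact F), Ext.mapExactFunctor_δ G h (h.map_of_exact G),
      Ext.comp_assoc_of_third_deg_zero, ← ih,
      ← Ext.comp_assoc (a₁₂ := 1) _ _ _ (zero_add 1) (add_comm 1 n) (by lia),
      ← Ext.δ_naturality (h.map_of_exact F) (h.map_of_exact G) (τ.app X₁) (τ.app X₂) (τ.app X₃)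
        (by simp) (by simp), Ext.comp_assoc_of_second_deg_zero]

section Bifunctor

variable (T : C ⥤ C ⥤ C)
  [∀ X, (T.obj X).Additive] [∀ X, PreservesFiniteLimits (T.obj X)]
  [∀ X, PreservesFiniteColimits (T.obj X)] [∀ X, (T.flip.obj X).Additive]
  [∀ X, PreservesFiniteLimits (T.flip.obj X)] [∀ X, PreservesFiniteColimits (T.flip.obj X)]

/-- The action of `T.obj X` on `Ext`, for a biexact bifunctor `T`. -/
noncomputable def Abelian.Ext.mapRight (X : C) {Z W : C} {n : ℕ} (y : Ext.{w} Z W n) :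
    Ext.{w} ((T.obj X).obj Z) ((T.obj X).obj W) n :=
  y.mapExactFunctor (T.obj X)

/-- The action of `T.flip.obj Z` on `Ext`, for a biexact bifunctor `T`. -/
noncomputable def Abelian.Ext.mapLeft (Z : C) {X Y : C} {n : ℕ} (x : Ext.{w} X Y n) :
    Ext.{w} ((T.obj X).obj Z) ((T.obj Y).obj Z) n :=
  x.mapExactFunctor (T.flip.obj Z)

lemma Abelian.Ext.δ_comp_mapRight {X₁ X₂ X₃ : C} {f : X₁ ⟶ X₂} {g : X₂ ⟶ X₃} {w : f ≫ g = 0}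
    (h : (ShortComplex.mk f g w).ShortExact) {Z W : C} {n : ℕ} (y : Ext.{w} Z W n) :
    ((Ext.δ h).mapLeft T Z).comp (y.mapRight T X₁) (add_comm 1 n) =
      (-1 : ℤ) ^ n • (y.mapRight T X₃).comp ((Ext.δ h).mapLeft T W) rfl := by
  have h₀ (V : C) : (T.map f).app V ≫ (T.map g).app V = 0 :=
    (ShortComplex.map ⟨f, g, w⟩ (T.flip.obj V)).zero
  have h' (V : C) : (ShortComplex.mk ((T.map f).app V) ((T.map g).app V) (h₀ V)).ShortExact :=
    h.map_of_exact (T.flip.obj V)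
  have e (V : C) : (Ext.δ.{w} h).mapLeft T V = Ext.δ (h' V) :=
    Ext.mapExactFunctor_δ (T.flip.obj V) h (h' V)
  simp only [e]
  induction y using Ext.induction_δ with
  | mk₀ Z t =>
    simp only [mapRight, Ext.mapExactFunctor_mk₀, pow_zero, one_smul]
    exact Ext.δ_naturality (h' Z) (h' W) ((T.obj X₁).map t) ((T.obj X₂).map t) ((T.obj X₃).map t)
      ((T.map f).naturality t) ((T.map g).naturality t)
  | δ_comp n Z₁ Z₂ Z₃ i p v k y ih =>
    have k₀ (V : C) : (T.obj V).map i ≫ (T.obj V).map p = 0 :=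
      (ShortComplex.map ⟨i, p, v⟩ (T.obj V)).zero
    have k' (V : C) : (ShortComplex.mk ((T.obj V).map i) ((T.obj V).map p) (k₀ V)).ShortExact :=
      k.map_of_exact (T.obj V)
    have e' (V : C) : (Ext.δ.{w} k).mapRight T V = Ext.δ (k' V) :=
      Ext.mapExactFunctor_δ (T.obj V) k (k' V)
    have c (V : C) : ((Ext.δ.{w} k).comp y (add_comm 1 n)).mapRight T V =
        (Ext.δ (k' V)).comp (y.mapRight T V) (add_comm 1 n) :=
      (Ext.mapExactFunctor_comp (T.obj V) _ _ _).trans (by rw [← e']; rfl)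
    have H := Ext.δ_comp_δ_add_δ_comp_δ.{w}
      (ShortComplex.mk (X₁ := (ShortComplex.mk i p v).map (T.obj X₁))
        (X₂ := (ShortComplex.mk i p v).map (T.obj X₂))
        (X₃ := (ShortComplex.mk i p v).map (T.obj X₃))
        ((ShortComplex.mk i p v).mapNatTrans (T.map f))
        ((ShortComplex.mk i p v).mapNatTrans (T.map g))
        (by ext <;> exact h₀ _)) (k' X₁) (k' X₂) (k' X₃) (h' Z₁) (h' Z₃)
    replace H : (Ext.δ.{w} (h' Z₃)).comp (Ext.δ (k' X₁)) (rfl : 1 + 1 = 2) +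
      (Ext.δ (k' X₃)).comp (Ext.δ (h' Z₁)) (rfl : 1 + 1 = 2) = 0 := H
    rw [c, c, ← Ext.comp_assoc (a₁₂ := 2) _ _ _ rfl _ (by lia), eq_neg_of_add_eq_zero_left H,
      Ext.neg_comp, Ext.comp_assoc (a₂₃ := n + 1) _ _ _ _ (by lia) (by lia), ih]
    rw [Ext.comp_zsmul, pow_succ, mul_neg_one, neg_smul,
      Ext.comp_assoc _ _ _ _ _ (by lia)]

lemma Abelian.Ext.mapLeft_comp_mapRight {X Y Z W : C} {m n p : ℕ} (x : Ext.{w} X Y m)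
    (y : Ext.{w} Z W n) (hp : m + n = p) :
    (x.mapLeft T Z).comp (y.mapRight T Y) hp =
      (-1 : ℤ) ^ (m * n) • (y.mapRight T X).comp (x.mapLeft T W) ((add_comm n m).trans hp) := by
  induction x using Ext.induction_δ generalizing p with
  | mk₀ X f =>
    obtain rfl : n = p := (zero_add n).symm.trans hp
    have c (V : C) : (Ext.mk₀.{w} f).mapLeft T V = Ext.mk₀ ((T.map f).app V) :=
      Ext.mapExactFunctor_mk₀ (T.flip.obj V) f
    rw [c, c, zero_mul, pow_zero, one_smul]
    exact Ext.mapExactFunctor_naturality (T.map f) y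
  | δ_comp m X₁ X₂ X₃ f g w h x ih =>
    have c (V : C) : ((Ext.δ.{w} h).comp x (add_comm 1 m)).mapLeft T V =
        ((Ext.δ h).mapLeft T V).comp (x.mapLeft T V) (add_comm 1 m) :=
      Ext.mapExactFunctor_comp (T.flip.obj V) _ _ _
    rw [c, c, Ext.comp_assoc (a₂₃ := m + n) _ _ _ _ rfl (by lia), ih rfl, Ext.comp_zsmul,
      ← Ext.comp_assoc (a₁₂ := n + 1) _ _ _ (add_comm 1 n) _ (by lia), Ext.δ_comp_mapRight,
      Ext.zsmul_comp, smul_smul, ← pow_add, Nat.succ_mul,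
      Ext.comp_assoc (a₂₃ := m + 1) _ _ _ _ (add_comm 1 m) (by lia)]

/-- If `U` is a two-sided unit for a biexact bifunctor on an abelian category with enough
projectives, and the two unit isomorphisms agree on `U`, then Yoneda composition on
`Ext U U` is graded commutative. -/
theorem Abelian.Ext.comp_comm_of_unit (U : C) (l : T.obj U ≅ 𝟭 C) (r : T.flip.obj U ≅ 𝟭 C)
    (hlr : l.hom.app U = r.hom.app U) {m n p : ℕ} (x : Ext.{w} U U m) (y : Ext.{w} U U n)
    (h : m + n = p) :
    x.comp y h = (-1 : ℤ) ^ (m * n) • y.comp x ((add_comm n m).trans h) := by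
  let i : (T.obj U).obj U ⟶ U := l.hom.app U
  let j : U ⟶ (T.obj U).obj U := l.inv.app U
  have hji : j ≫ i = 𝟙 _ := l.inv_hom_id_app U
  have hx : (Ext.mk₀ i).comp x (zero_add m) = (x.mapLeft T U).comp (Ext.mk₀ i) (add_zero m) := by
    have := Ext.mapExactFunctor_naturality r.hom x
    rw [Ext.mapExactFunctor_id, ← hlr] at this
    exact this
  have hy : (Ext.mk₀ i).comp y (zero_add n) = (y.mapRight T U).comp (Ext.mk₀ i) (add_zero n) := by
    have := Ext.mapExactFunctor_naturality l.hom y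
    rw [Ext.mapExactFunctor_id] at this
    exact this
  have cancel {q : ℕ} {a b : Ext.{w} U U q}
      (hab : (Ext.mk₀ i).comp a (zero_add q) = (Ext.mk₀ i).comp b (zero_add q)) : a = b := by
    simpa [hji] using congrArg (fun z ↦ (Ext.mk₀ j).comp z (zero_add q)) hab
  apply cancel
  rw [Ext.comp_zsmul,
    ← Ext.comp_assoc (a₁₂ := m) _ _ _ (zero_add m) h (by lia), hx,
    ← Ext.comp_assoc (a₁₂ := n) _ _ _ (zero_add n) ((add_comm n m).trans h) (by lia), hy,
    Ext.comp_assoc_of_second_deg_zero, Ext.comp_assoc_of_second_deg_zero, hx, hy,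
    ← Ext.comp_assoc_of_third_deg_zero, ← Ext.comp_assoc_of_third_deg_zero,
    Ext.mapLeft_comp_mapRight, Ext.zsmul_comp]

end Bifunctor

end GradedInterchange
end CategoryTheory

namespace ModuleCat

open Limits TensorProduct

variable {k A : Type u} [Field k] [Ring A]

section Algebra
variable [Algebra k A]

/-- The action of `A ⊗ A` on the tensor product of two `A`-modules. -/
noncomputable def tensorAct (X Y : ModuleCat.{u} A) : A ⊗[k] A →ₐ[k] Module.End k (X ⊗[k] Y) :=
  (Module.endTensorEndAlgHom (R := k) (S := k) (A := k)).comp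
    (Algebra.TensorProduct.map (Algebra.lsmul k k X) (Algebra.lsmul k k Y))

@[simp]
lemma tensorAct_tmul_tmul (X Y : ModuleCat.{u} A) (a b : A) (x : X) (y : Y) :
    tensorAct (k := k) X Y (a ⊗ₜ b) (x ⊗ₜ y) = (a • x) ⊗ₜ (b • y) :=
  rfl

lemma tensorAct_map {X X' Y Y' : ModuleCat.{u} A} (f : X ⟶ X') (g : Y ⟶ Y') (t : A ⊗[k] A)
    (z : X ⊗[k] Y) :
    TensorProduct.map (f.hom.restrictScalars k) (g.hom.restrictScalars k) (tensorAct X Y t z) =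
      tensorAct X' Y' t
        (TensorProduct.map (f.hom.restrictScalars k) (g.hom.restrictScalars k) z) := by
  induction t with
  | zero => simp
  | add s t hs ht => simp only [map_add, LinearMap.add_apply, hs, ht]
  | tmul a b =>
    induction z with
    | zero => simp
    | add y z hy hz => simp only [map_add, hy, hz]
    | tmul x y => simp

end Algebra

variable [Bialgebra k A]

variable (k) in
/-- The tensor product over `k` of two modules over a bialgebra, with the diagonal action. -/
def DiagonalTensor (X Y : ModuleCat.{u} A) : Type u :=
  X ⊗[k] Y

noncomputable instance (X Y : ModuleCat.{u} A) : AddCommGroup (DiagonalTensor k X Y) :=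
  inferInstanceAs (AddCommGroup (X ⊗[k] Y))

noncomputable instance (X Y : ModuleCat.{u} A) : Module A (DiagonalTensor k X Y) :=
  letI : Module (Module.End k (X ⊗[k] Y)) (DiagonalTensor k X Y) :=
    inferInstanceAs (Module (Module.End k (X ⊗[k] Y)) (X ⊗[k] Y))
  Module.compHom _ ((tensorAct X Y).comp (Bialgebra.comulAlgHom k A)).toRingHom

/-- The map induced on diagonal tensor products by two `A`-linear maps. -/
noncomputable def diagonalTensorMap {X X' Y Y' : ModuleCat.{u} A} (f : X ⟶ X') (g : Y ⟶ Y') :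
    DiagonalTensor k X Y →ₗ[A] DiagonalTensor k X' Y' where
  toFun := TensorProduct.map (f.hom.restrictScalars k) (g.hom.restrictScalars k)
  map_add' := map_add _
  map_smul' a z := tensorAct_map f g (Coalgebra.comul a) z

lemma diagonalTensorMap_ext {X Y : ModuleCat.{u} A} {M : Type*} [AddCommGroup M] [Module A M]
    {f g : DiagonalTensor k X Y →ₗ[A] M}
    (h : ∀ (x : X) (y : Y), f (x ⊗ₜ[k] y) = g (x ⊗ₜ[k] y)) : f = g := by
  ext z
  refine TensorProduct.induction_on (motive := fun z ↦ f z = g z) z ?_ h ?_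
  · exact (map_zero f).trans (map_zero g).symm
  · intro x y hx hy
    exact (map_add f x y).trans ((congrArg₂ (· + ·) hx hy).trans (map_add g x y).symm)

variable (k A) in
/-- The bifunctor sending two modules over a bialgebra to their diagonal tensor product. -/
noncomputable def diagonalTensor : ModuleCat.{u} A ⥤ ModuleCat.{u} A ⥤ ModuleCat.{u} A where
  obj X :=
    { obj Y := of A (DiagonalTensor k X Y)
      map g := ofHom (diagonalTensorMap (𝟙 X) g)
      map_id Y := hom_ext (diagonalTensorMap_ext fun _ _ ↦ rfl)
      map_comp f g := hom_ext (diagonalTensorMap_ext fun _ _ ↦ rfl) }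
  map f :=
    { app Y := ofHom (diagonalTensorMap f (𝟙 Y))
      naturality _ _ _ := hom_ext (diagonalTensorMap_ext fun _ _ ↦ rfl) }
  map_id X := by ext Y : 2; exact hom_ext (diagonalTensorMap_ext fun _ _ ↦ rfl)
  map_comp f g := by ext Y : 2; exact hom_ext (diagonalTensorMap_ext fun _ _ ↦ rfl)

instance (X : ModuleCat.{u} A) : ((diagonalTensor k A).obj X).Additive where
  map_add {_ _ f g} :=
    hom_ext (diagonalTensorMap_ext fun x y ↦ TensorProduct.tmul_add x (f y) (g y))

instance (Y : ModuleCat.{u} A) : ((diagonalTensor k A).flip.obj Y).Additive where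
  map_add {_ _ f g} :=
    hom_ext (diagonalTensorMap_ext fun x y ↦ TensorProduct.add_tmul (f x) (g x) y)

lemma diagonalTensor_obj_map_exact (X : ModuleCat.{u} A) (S : ShortComplex (ModuleCat.{u} A))
    (h : S.Exact) : (S.map ((diagonalTensor k A).obj X)).Exact := by
  rw [ShortComplex.ShortExact.moduleCat_exact_iff_function_exact] at h ⊢
  exact Module.Flat.lTensor_exact X (f := S.f.hom.restrictScalars k)
    (g := S.g.hom.restrictScalars k) h

lemma diagonalTensor_flip_obj_map_exact (Y : ModuleCat.{u} A)
    (S : ShortComplex (ModuleCat.{u} A)) (h : S.Exact) :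
    (S.map ((diagonalTensor k A).flip.obj Y)).Exact := by
  rw [ShortComplex.ShortExact.moduleCat_exact_iff_function_exact] at h ⊢
  exact Module.Flat.rTensor_exact Y (f := S.f.hom.restrictScalars k)
    (g := S.g.hom.restrictScalars k) h

instance (X : ModuleCat.{u} A) : PreservesFiniteLimits ((diagonalTensor k A).obj X) := by
  have := ((Functor.exact_tfae ((diagonalTensor k A).obj X)).out 1 3).mp
    (diagonalTensor_obj_map_exact X)
  exact this.1

instance (X : ModuleCat.{u} A) : PreservesFiniteColimits ((diagonalTensor k A).obj X) := by
  have := ((Functor.exact_tfae ((diagonalTensor k A).obj X)).out 1 3).mp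
    (diagonalTensor_obj_map_exact X)
  exact this.2

instance (Y : ModuleCat.{u} A) : PreservesFiniteLimits ((diagonalTensor k A).flip.obj Y) := by
  have := ((Functor.exact_tfae ((diagonalTensor k A).flip.obj Y)).out 1 3).mp
    (diagonalTensor_flip_obj_map_exact Y)
  exact this.1

instance (Y : ModuleCat.{u} A) : PreservesFiniteColimits ((diagonalTensor k A).flip.obj Y) := by
  have := ((Functor.exact_tfae ((diagonalTensor k A).flip.obj Y)).out 1 3).mp
    (diagonalTensor_flip_obj_map_exact Y)
  exact this.2

section Unit

variable {U : ModuleCat.{u} A} (e : U)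

lemma tensorAct_tmul_left (he : ∀ a : A, a • e = Coalgebra.counit (R := k) a • e)
    (X : ModuleCat.{u} A) (t : A ⊗[k] A) (x : X) :
    tensorAct U X t (e ⊗ₜ[k] x) =
      e ⊗ₜ (TensorProduct.lid k A (Coalgebra.counit.rTensor A t) • x) := by
  induction t with
  | zero => simp
  | add s t hs ht =>
    simp only [map_add, LinearMap.add_apply, hs, ht, add_smul, TensorProduct.tmul_add]
  | tmul a b => simp [he, TensorProduct.smul_tmul]

lemma tensorAct_tmul_right (he : ∀ a : A, a • e = Coalgebra.counit (R := k) a • e)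
    (X : ModuleCat.{u} A) (t : A ⊗[k] A) (x : X) :
    tensorAct X U t (x ⊗ₜ[k] e) =
      (TensorProduct.rid k A (Coalgebra.counit.lTensor A t) • x) ⊗ₜ e := by
  induction t with
  | zero => simp
  | add s t hs ht =>
    simp only [map_add, LinearMap.add_apply, hs, ht, add_smul, TensorProduct.add_tmul]
  | tmul a b => simp [he, TensorProduct.smul_tmul]

/-- The `A`-linear map `X → U ⊗ X` given by an element of `U` on which `A` acts trivially. -/
noncomputable def tmulLeft (he : ∀ a : A, a • e = Coalgebra.counit (R := k) a • e)
    (X : ModuleCat.{u} A) : X →ₗ[A] DiagonalTensor k U X where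
  toFun x := e ⊗ₜ[k] x
  map_add' := TensorProduct.tmul_add e
  map_smul' a x := by
    have := tensorAct_tmul_left e he X (Coalgebra.comul a) x
    rw [Coalgebra.rTensor_counit_comul, TensorProduct.lid_tmul, one_smul] at this
    exact this.symm

/-- The `A`-linear map `X → X ⊗ U` given by an element of `U` on which `A` acts trivially. -/
noncomputable def tmulRight (he : ∀ a : A, a • e = Coalgebra.counit (R := k) a • e)
    (X : ModuleCat.{u} A) : X →ₗ[A] DiagonalTensor k X U where
  toFun x := x ⊗ₜ[k] e
  map_add' x y := TensorProduct.add_tmul x y e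
  map_smul' a x := by
    have := tensorAct_tmul_right e he X (Coalgebra.comul a) x
    rw [Coalgebra.lTensor_counit_comul, TensorProduct.rid_tmul, one_smul] at this
    exact this.symm

variable (he : ∀ a : A, a • e = Coalgebra.counit (R := k) a • e)
  (hb : Function.Bijective fun c : k ↦ c • e)
include hb

lemma tmulLeft_bijective (X : ModuleCat.{u} A) : Function.Bijective (tmulLeft e he X) := by
  let E : k ≃ₗ[k] U := .ofBijective (LinearMap.toSpanSingleton k U e) hb
  let F := (TensorProduct.lid k X).symm ≪≫ₗ TensorProduct.congr E (.refl k X)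
  have hF (x : X) : F x = e ⊗ₜ[k] x := by
    change ((1 : k) • e) ⊗ₜ[k] x = _
    rw [one_smul]
  have h : (tmulLeft e he X : X → DiagonalTensor k U X) = F := funext fun x ↦ (hF x).symm
  rw [h]
  exact F.bijective

lemma tmulRight_bijective (X : ModuleCat.{u} A) : Function.Bijective (tmulRight e he X) := by
  let E : k ≃ₗ[k] U := .ofBijective (LinearMap.toSpanSingleton k U e) hb
  let F := (TensorProduct.rid k X).symm ≪≫ₗ TensorProduct.congr (.refl k X) E
  have hF (x : X) : F x = x ⊗ₜ[k] e := by
    change x ⊗ₜ[k] ((1 : k) • e) = _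
    rw [one_smul]
  have h : (tmulRight e he X : X → DiagonalTensor k X U) = F := funext fun x ↦ (hF x).symm
  rw [h]
  exact F.bijective

/-- The left unit isomorphism for the diagonal tensor product. -/
noncomputable def diagonalTensorLeftUnitor : (diagonalTensor k A).obj U ≅ 𝟭 _ :=
  (NatIso.ofComponents
    (fun X ↦ (LinearEquiv.ofBijective _ (tmulLeft_bijective e he hb X)).toModuleIso)
    (fun _ ↦ rfl)).symm

/-- The right unit isomorphism for the diagonal tensor product. -/
noncomputable def diagonalTensorRightUnitor : (diagonalTensor k A).flip.obj U ≅ 𝟭 _ :=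
  (NatIso.ofComponents
    (fun X ↦ (LinearEquiv.ofBijective _ (tmulRight_bijective e he hb X)).toModuleIso)
    (fun _ ↦ rfl)).symm

lemma diagonalTensorLeftUnitor_hom_app_self :
    (diagonalTensorLeftUnitor e he hb).hom.app U =
      (diagonalTensorRightUnitor e he hb).hom.app U := by
  have h : (diagonalTensorLeftUnitor e he hb).inv.app U =
      (diagonalTensorRightUnitor e he hb).inv.app U := by
    ext x
    obtain ⟨c, rfl⟩ := hb.2 x
    change e ⊗ₜ[k] (c • e) = (c • e) ⊗ₜ[k] e
    rw [TensorProduct.smul_tmul]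
  have h' := (diagonalTensorLeftUnitor e he hb).inv_hom_id_app U
  rw [h] at h'
  rw [← cancel_epi ((diagonalTensorRightUnitor e he hb).inv.app U), h']
  exact ((diagonalTensorRightUnitor e he hb).inv_hom_id_app U).symm

end Unit

end ModuleCat

theorem hopf_cohomology_graded_comm
    {k A : Type u} [Field k] [Ring A] [HopfAlgebra k A] [FiniteDimensional k A]
    -- the trivial `A`-module structure on `k`, given by the counit `ε`
    [Module A k] (hk : ∀ (a : A) (c : k), a • c = Coalgebra.counit (R := k) a * c)
    [HasExt.{v} (ModuleCat.{u} A)] :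
    -- graded commutativity: `x·y = (−1)^{mn} y·x`
    (∀ (m n : ℕ)
      (x : Abelian.Ext (ModuleCat.of A k) (ModuleCat.of A k) m)
      (y : Abelian.Ext (ModuleCat.of A k) (ModuleCat.of A k) n),
      x.comp y rfl = ((-1 : ℤ) ^ (m * n)) • y.comp x (Nat.add_comm n m)) ∧
    -- in particular, the even part `H^ev(A,k)` is a commutative ring
    (∀ (m n : ℕ), Even m → Even n →
      ∀ (x : Abelian.Ext (ModuleCat.of A k) (ModuleCat.of A k) m)
        (y : Abelian.Ext (ModuleCat.of A k) (ModuleCat.of A k) n),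
      x.comp y rfl = y.comp x (Nat.add_comm n m)) := by
  let U : ModuleCat.{u} A := ModuleCat.of A k
  let e : U := (1 : k)
  have hs (c : k) : algebraMap k A c • (1 : k) = c := by
    rw [hk, mul_one, Bialgebra.counit_algebraMap]
  have he (a : A) : a • e = algebraMap k A (Coalgebra.counit (R := k) a) • e :=
    ((hk a 1).trans (mul_one _)).trans (hs _).symm
  have hb : Function.Bijective fun c : k ↦ algebraMap k A c • e :=
    (funext hs : (fun c : k ↦ algebraMap k A c • (1 : k)) = id) ▸ Function.bijective_id
  have comm (m n : ℕ) (x : Abelian.Ext.{v} U U m) (y : Abelian.Ext.{v} U U n) :=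
    Abelian.Ext.comp_comm_of_unit (ModuleCat.diagonalTensor k A) U
      (ModuleCat.diagonalTensorLeftUnitor e he hb) (ModuleCat.diagonalTensorRightUnitor e he hb)
      (ModuleCat.diagonalTensorLeftUnitor_hom_app_self e he hb) x y rfl
  refine ⟨comm, fun m n hm _ x y ↦ ?_⟩
  rw [comm, (hm.mul_right n).neg_one_pow, one_smul]
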